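/- Let Q(x, y, z) be a positive definite ternary quadratic form with rational coefficients (i.e., Q(x, y, z) > 0 for every rational triple (x, y, z) ≠ (0, 0, 0)). Then there exist positive integers M and r such that no positive integer congruent to r modulo M is represented by Q over the rationals; in particular, infinitely many positive integers are not of the form Q(x, y, z) with x, y, z rational. -/

import Mathlib

lemma aux_local (p : ℕ) [Fact p.Prime] (a b c x y z w k : ℤ)
    (hb : ¬ (p:ℤ) ∣ b) (hc : ¬ (p:ℤ) ∣ c) (ha : ¬ (p:ℤ) ∣ a)
    (h : (-(a*b*c) + p * k) * p * w^2 = (p*a)*x^2 + b*y^2 + c*z^2)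
    (hprim : ¬ ((p:ℤ) ∣ x ∧ (p:ℤ) ∣ y ∧ (p:ℤ) ∣ z ∧ (p:ℤ) ∣ w)) :
    IsSquare (((-(b*c) : ℤ)) : ZMod p) := by
  have hp0 : (p:ℤ) ≠ 0 := by exact_mod_cast (Fact.out : p.Prime).ne_zero
  simp only [← ZMod.intCast_zmod_eq_zero_iff_dvd] at hb hc ha 
  have h1 := congrArg (Int.cast : ℤ → ZMod p) h
  push_cast at h1
  simp only [CharP.cast_eq_zero, zero_mul, mul_zero, zero_add] at h1
  by_cases hy : (y : ZMod p) = 0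
  · have hz : (z : ZMod p) = 0 := by
      rw [hy] at h1
      have : (c : ZMod p) * (z:ZMod p)^2 = 0 := by linear_combination -h1
      simpa [hc] using this
    obtain ⟨y1, rfl⟩ := (ZMod.intCast_zmod_eq_zero_iff_dvd y p).1 hy
    obtain ⟨z1, rfl⟩ := (ZMod.intCast_zmod_eq_zero_iff_dvd z p).1 hz
    have h2 : (-(a*b*c) + p * k) * w^2 = a*x^2 + p * (b*y1^2 + c*z1^2) := by
      apply mul_left_cancel₀ hp0
      linear_combination h
    have h3 := congrArg (Int.cast : ℤ → ZMod p) h2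
    push_cast at h3
    simp only [CharP.cast_eq_zero, zero_mul, add_zero] at h3
    have h4 : (x : ZMod p)^2 = -(b*c) * (w:ZMod p)^2 := by
      apply mul_left_cancel₀ ha
      linear_combination -h3
    by_cases hw : (w : ZMod p) = 0
    · exfalso
      have hx : (x : ZMod p) = 0 := by
        rw [hw] at h4; simpa using h4
      exact hprim ⟨(ZMod.intCast_zmod_eq_zero_iff_dvd x p).1 hx, dvd_mul_right _ _, dvd_mul_right _ _,
        (ZMod.intCast_zmod_eq_zero_iff_dvd w p).1 hw⟩
    · refine ⟨x / w, ?_⟩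
      push_cast
      field_simp
      linear_combination -h4
  · refine ⟨c * z / y, ?_⟩
    push_cast
    field_simp
    linear_combination h1

lemma aux_jac (a : ℕ) (m : ℤ) (h : ∀ p : ℕ, p.Prime → p ∣ a → IsSquare (m : ZMod p) ∧ ¬ (p:ℤ) ∣ m) :
    jacobiSym m a = 1 := by
  unfold jacobiSym
  apply List.prod_eq_one
  intro q hq
  obtain ⟨p, hp, hq⟩ := List.mem_pmap.1 hq
  rw [← hq]
  have pp := Nat.prime_of_mem_primeFactorsList hp
  haveI : Fact p.Prime := ⟨pp⟩
  obtain ⟨h1, h2⟩ := h p pp (Nat.dvd_of_mem_primeFactorsList hp)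
  rw [legendreSym.eq_one_iff]
  · exact h1
  · rwa [Ne, ZMod.intCast_zmod_eq_zero_iff_dvd]

lemma sq8 (x : ℤ) : ((x:ZMod 8)^2 = 1 ∧ ¬ 2 ∣ x) ∨ (((x:ZMod 8)^2 = 0 ∨ (x:ZMod 8)^2 = 4) ∧ 2 ∣ x) := by
  have h : x % 8 = 0 ∨ x % 8 = 1 ∨ x % 8 = 2 ∨ x % 8 = 3 ∨ x % 8 = 4 ∨ x % 8 = 5 ∨ x % 8 = 6 ∨ x % 8 = 7 := by omega
  have e : (x : ZMod 8) = ((x % 8 : ℤ) : ZMod 8) := by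
    rw [ZMod.intCast_eq_intCast_iff]; exact (Int.mod_modEq x 8).symm
  rw [e]
  rcases h with h|h|h|h|h|h|h|h <;> rw [h] <;> first | (left; exact ⟨by decide, by omega⟩) | (right; exact ⟨by decide, by omega⟩)

lemma odd8 (x : ℤ) (hx : ¬ 2 ∣ x) :
   (x:ZMod 8) = ((x % 8 : ℤ) : ZMod 8) ∧ (x % 8 = 1 ∨ x % 8 = 3 ∨ x % 8 = 5 ∨ x % 8 = 7) := by
  refine ⟨?_, by omega⟩
  rw [ZMod.intCast_eq_intCast_iff]; exact (Int.mod_modEq x 8).symm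

lemma dec1 : ∀ a ∈ ([1,3,5,7] : List (ZMod 8)), ∀ b ∈ ([a,a+4] : List (ZMod 8)),
    ∀ c ∈ ([a,a+4] : List (ZMod 8)), ∀ X ∈ ([0,1,4] : List (ZMod 8)), ∀ Y ∈ ([0,1,4] : List (ZMod 8)),
    ∀ Z ∈ ([0,1,4] : List (ZMod 8)), ∀ W ∈ ([0,1,4] : List (ZMod 8)),
    -(a*b*c)*W = a*X+b*Y+c*Z → X ≠ 1 ∧ Y ≠ 1 ∧ Z ≠ 1 ∧ W ≠ 1 := by
  decide +kernel

lemma dec2 : ∀ a ∈ ([1,3,5,7] : List (ZMod 8)), ∀ b ∈ ([1,3,5,7] : List (ZMod 8)),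
    ∀ c ∈ ([1,3,5,7] : List (ZMod 8)), ∀ X ∈ ([0,1,4] : List (ZMod 8)), 
    ∀ W ∈ ([0,1,4] : List (ZMod 8)),
    -(2*a*b*c)*W = 2*a*X+b+c → b + c = 0 ∨ 2*a+b+c = 0 := by
  decide +kernel

lemma dec3 : ∀ a ∈ ([1,3,5,7] : List (ZMod 8)), ∀ b ∈ ([1,3,5,7] : List (ZMod 8)),
    ∀ c ∈ ([1,3,5,7] : List (ZMod 8)), ∀ X ∈ ([0,1,4] : List (ZMod 8)), ∀ Y ∈ ([0,1,4] : List (ZMod 8)),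
    ∀ Z ∈ ([0,1,4] : List (ZMod 8)), ∀ W ∈ ([0,1,4] : List (ZMod 8)),
    -(a*b*c)*W = a*X+2*b*Y+2*c*Z → (b + c = 0 ∨ 2*a+b+c = 0) ∨ (X ≠ 1 ∧ W ≠ 1) := by
  decide +kernel

lemma aux_odd (a b c x y z w k : ℤ) (ha : ¬ 2 ∣ a) 
    (h : (-(a*b*c) + 8 * k) * w^2 = a*x^2 + b*y^2 + c*z^2)
    (hprim : ¬ (2 ∣ x ∧ 2 ∣ y ∧ 2 ∣ z ∧ 2 ∣ w)) (hab : a % 4 = b % 4) (hac : a % 4 = c % 4) : False := by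
  have h8 : (8 : ZMod 8) = 0 := rfl
  have hsq : ∀ u : ℤ, (u : ZMod 8)^2 ∈ ([0,1,4] : List (ZMod 8)) := by
    intro u
    have := sq8 u; simp; tauto
  have h1 := congrArg (Int.cast : ℤ → ZMod 8) h
  push_cast at h1
  rw [show (8 : ZMod 8) = 0 from rfl, zero_mul, add_zero] at h1
  have key := dec1 a ?_ b ?_ c ?_ (x^2) ?_ (y^2) ?_ (z^2) ?_ (w^2) ?_ h1
  · obtain ⟨hx, hy, hz, hw⟩ := key
    exact hprim ⟨((sq8 x).resolve_left fun h => hx h.1).2, ((sq8 y).resolve_left fun h => hy h.1).2,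
      ((sq8 z).resolve_left fun h => hz h.1).2, ((sq8 w).resolve_left fun h => hw h.1).2⟩
  · obtain ⟨e, h⟩ := odd8 a ha
    rw [e]; rcases h with h|h|h|h <;> rw [h] <;> decide
  · have : ∃ m, b = a + 4 * m := ⟨(b-a)/4, by omega⟩
    obtain ⟨m, rfl⟩ := this
    obtain ⟨j, rfl|rfl⟩ := Int.even_or_odd' m
    · have : ((a + 4 * (2*j) : ℤ) : ZMod 8) = a := by
        push_cast; linear_combination (j:ZMod 8) * h8
      simp [this]
    · have : ((a + 4 * (2*j+1) : ℤ) : ZMod 8) = a + 4 := by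
        push_cast; linear_combination (j:ZMod 8) * h8
      simp [this]
  · have : ∃ m, c = a + 4 * m := ⟨(c-a)/4, by omega⟩
    obtain ⟨m, rfl⟩ := this
    obtain ⟨j, rfl|rfl⟩ := Int.even_or_odd' m
    · have : ((a + 4 * (2*j) : ℤ) : ZMod 8) = a := by
        push_cast; linear_combination (j:ZMod 8) * h8
      simp [this]
    · have : ((a + 4 * (2*j+1) : ℤ) : ZMod 8) = a + 4 := by
        push_cast; linear_combination (j:ZMod 8) * h8
      simp [this]
  · exact hsq x
  · exact hsq y
  · exact hsq z
  · exact hsq w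

lemma aux_even (a b c x y z w k : ℤ) (ha : ¬ 2 ∣ a) (hb : ¬ 2 ∣ b) (hc : ¬ 2 ∣ c)
    (h : (-(a*b*c) + 8 * k) * 2 * w^2 = 2*a*x^2 + b*y^2 + c*z^2)
    (hprim : ¬ (2 ∣ x ∧ 2 ∣ y ∧ 2 ∣ z ∧ 2 ∣ w)) : (b + c) % 8 = 0 ∨ (2*a+b+c) % 8 = 0 := by
  have hod : ∀ u : ℤ, ¬ 2 ∣ u → (u : ZMod 8) ∈ ([1,3,5,7] : List (ZMod 8)) := by
    intro u hu
    obtain ⟨e, h⟩ := odd8 u hu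
    rw [e]; rcases h with h|h|h|h <;> rw [h] <;> decide
  have hsq : ∀ u : ℤ, (u : ZMod 8)^2 ∈ ([0,1,4] : List (ZMod 8)) := by
    intro u
    have := sq8 u; simp; tauto
  suffices hh : ((b:ZMod 8) + c = 0 ∨ 2*(a:ZMod 8)+b+c = 0) by
    rcases hh with hh | hh
    · left
      apply Int.emod_eq_zero_of_dvd
      exact (ZMod.intCast_zmod_eq_zero_iff_dvd (b+c) 8).1 (by push_cast; exact hh)
    · right
      apply Int.emod_eq_zero_of_dvd
      exact (ZMod.intCast_zmod_eq_zero_iff_dvd (2*a+b+c) 8).1 (by push_cast; exact hh)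
  have h8 : (8 : ZMod 8) = 0 := rfl
  have hpar : Even (b*y^2+c*z^2) := ⟨(-(a*b*c) + 8 * k) * w^2 - a*x^2, by linear_combination -h⟩
  rw [← even_iff_two_dvd] at ha hb hc
  have hyz : Even y ↔ Even z := by
    simp only [Int.even_add, Int.even_mul, Int.even_pow] at hpar
    tauto
  rw [even_iff_two_dvd] at ha hb hc
  by_cases hy : Even y
  · have hz := hyz.1 hy
    rw [even_iff_two_dvd] at hy hz
    obtain ⟨y1, rfl⟩ := hy
    obtain ⟨z1, rfl⟩ := hz
    have h2 : (-(a*b*c) + 8 * k) * w^2 = a*x^2 + 2*b*y1^2 + 2*c*z1^2 := by linarith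
    have h1 := congrArg (Int.cast : ℤ → ZMod 8) h2
    push_cast at h1
    rw [h8, zero_mul, add_zero] at h1
    rcases dec3 a (hod a ha) b (hod b hb) c (hod c hc) _ (hsq x) _ (hsq y1) _ (hsq z1) _ (hsq w) h1 with h3 | ⟨h3, h4⟩
    · exact h3
    · exfalso
      have := sq8 x; have := sq8 w
      exact hprim ⟨by tauto, dvd_mul_right _ _, dvd_mul_right _ _, by tauto⟩
  · have hz : ¬ Even z := fun h => hy (hyz.2 h)
    rw [even_iff_two_dvd] at hy hz
    have hy1 : (y:ZMod 8)^2 = 1 := by have := sq8 y; tauto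
    have hz1 : (z:ZMod 8)^2 = 1 := by have := sq8 z; tauto
    have h1 := congrArg (Int.cast : ℤ → ZMod 8) h
    push_cast at h1
    rw [h8, zero_mul, add_zero, hy1, hz1] at h1
    exact dec2 a (hod a ha) b (hod b hb) c (hod c hc) _ (hsq x) _ (hsq w) (by linear_combination h1)

lemma jac_prod (a b c : ℕ) (ha : Odd a) (hb : Odd b) (hc : Odd c)
    (h1 : a.Coprime b) (h2 : a.Coprime c) (h3 : b.Coprime c) :
    jacobiSym (-(b*c)) a * jacobiSym (-(a*c)) b * jacobiSym (-(a*b)) c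
     = if a % 4 = b % 4 ∧ a % 4 = c % 4 then 1 else -1 := by
  have e : ∀ u v : ℕ, u.Coprime v → jacobiSym u v * jacobiSym u v = 1 := by
    intro u v h
    have := jacobiSym.sq_one (a := (u:ℤ)) (b := v) (by simpa using h)
    rwa [sq] at this
  have neg : ∀ u v w : ℕ, Odd w → jacobiSym (-(u*v)) w = ZMod.χ₄ w * (jacobiSym u w * jacobiSym v w) := by
    intro u v w hw
    rw [jacobiSym.neg _ hw, jacobiSym.mul_left]
  rw [neg _ _ _ ha, neg _ _ _ hb, neg _ _ _ hc]
  rw [jacobiSym.quadratic_reciprocity hb ha, jacobiSym.quadratic_reciprocity hc ha, jacobiSym.quadratic_reciprocity hc hb]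
  have e1 := e a b h1
  have e2 := e a c h2
  have e3 := e b c h3
  have : ZMod.χ₄ a * ((-1) ^ (b / 2 * (a / 2)) * jacobiSym (↑a) b * ((-1) ^ (c / 2 * (a / 2)) * jacobiSym (↑a) c)) *
      (ZMod.χ₄ ↑b * (jacobiSym (↑a) b * ((-1) ^ (c / 2 * (b / 2)) * jacobiSym (↑b) c))) *
    (ZMod.χ₄ ↑c * (jacobiSym (↑a) c * jacobiSym (↑b) c))
    = ZMod.χ₄ a * ZMod.χ₄ b * ZMod.χ₄ c * (-1) ^ (b / 2 * (a / 2)) * (-1) ^ (c / 2 * (a / 2)) * (-1) ^ (c / 2 * (b / 2)) * (jacobiSym a b * jacobiSym a b) * (jacobiSym a c * jacobiSym a c) * (jacobiSym b c * jacobiSym b c) := by ring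
  rw [this, e1, e2, e3]
  rw [ZMod.χ₄_nat_eq_if_mod_four, ZMod.χ₄_nat_eq_if_mod_four, ZMod.χ₄_nat_eq_if_mod_four]
  have o : ∀ u : ℕ, Odd u → (u % 4 = 1 ∧ u % 2 = 1 ∧ ∃ m, u/2 = 2*m) ∨ (u % 4 = 3 ∧ u % 2 = 1 ∧ ∃ m, u/2 = 2*m+1) := by
    intro u hu
    rw [Nat.odd_iff] at hu
    have : u % 4 = 1 ∨ u % 4 = 3 := by omega
    rcases this with h | h
    · left; exact ⟨h, hu, u/4, by omega⟩
    · right; exact ⟨h, hu, u/4, by omega⟩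
  rcases o a ha with ⟨a1, a2, l, a3⟩ | ⟨a1, a2, l, a3⟩ <;> rcases o b hb with ⟨b1, b2, m, b3⟩ | ⟨b1, b2, m, b3⟩ <;>
   rcases o c hc with ⟨c1, c2, n, c3⟩ | ⟨c1, c2, n, c3⟩ <;> simp [a1, a2, a3, b1, b2, b3, c1, c2, c3, pow_mul, pow_add, mul_add, add_mul]

lemma core_p (a b c : ℕ) (n x y z w j : ℤ) (sa : Squarefree a)
    (h1 : a.Coprime b) (h2 : a.Coprime c)
    (hn : n = -(a*b*c) + 16 * (a*b*c)^2 * j) (h : n * w^2 = a*x^2+b*y^2+c*z^2)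
    (hprim : ∀ p : ℕ, p.Prime → ¬ ((p:ℤ) ∣ x ∧ (p:ℤ) ∣ y ∧ (p:ℤ) ∣ z ∧ (p:ℤ) ∣ w))
    (p : ℕ) (pp : p.Prime) (hp : p ∣ a) :
    IsSquare (((-(b*c) : ℤ)) : ZMod p) ∧ ¬ (p:ℤ) ∣ (-(b*c) : ℤ) := by
  haveI : Fact p.Prime := ⟨pp⟩
  have hb : ¬ (p:ℤ) ∣ b := by
    intro hb
    exact pp.one_lt.ne' (Nat.eq_one_of_dvd_coprimes h1 hp (by exact_mod_cast hb))
  have hc : ¬ (p:ℤ) ∣ c := by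
    intro hb
    exact pp.one_lt.ne' (Nat.eq_one_of_dvd_coprimes h2 hp (by exact_mod_cast hb))
  obtain ⟨a', rfl⟩ := hp
  have ha : ¬ (p:ℤ) ∣ a' := by
    intro hb
    have hb : p ∣ a' := by exact_mod_cast hb
    have := sa p (mul_dvd_mul_left p hb)
    exact pp.one_lt.ne' (Nat.isUnit_iff.1 this)
  refine ⟨aux_local p a' b c x y z w (16*(a'*b*c)^2*j) hb hc ha ?_ (hprim p pp), ?_⟩
  · rw [hn] at h
    push_cast at h
    linear_combination h
  · rw [dvd_neg]
    intro hd
    rcases (Nat.prime_iff_prime_int.1 pp).dvd_or_dvd hd with hd | hd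
    · exact hb hd
    · exact hc hd

lemma core_odd (a b c : ℕ) (n x y z w j : ℤ) (sa : Squarefree a) (sb : Squarefree b) (sc : Squarefree c)
    (h1 : a.Coprime b) (h2 : a.Coprime c) (h3 : b.Coprime c)
    (oa : Odd a) (ob : Odd b) (oc : Odd c)
    (hn : n = -(a*b*c) + 16 * (a*b*c)^2 * j) (h : n * w^2 = a*x^2+b*y^2+c*z^2)
    (hprim : ∀ p : ℕ, p.Prime → ¬ ((p:ℤ) ∣ x ∧ (p:ℤ) ∣ y ∧ (p:ℤ) ∣ z ∧ (p:ℤ) ∣ w)) : False := by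
  have j1 := aux_jac a (-(b*c)) (core_p a b c n x y z w j sa h1 h2 hn h hprim)
  have j2 := aux_jac b (-(a*c)) (core_p b a c n y x z w j sb h1.symm h3 (by rw [hn]; ring) (by rw [h]; ring)
    (fun p pp hh => hprim p pp (by tauto)))
  have j3 := aux_jac c (-(a*b)) (core_p c a b n z x y w j sc h2.symm h3.symm (by rw [hn]; ring) (by rw [h]; ring)
    (fun p pp hh => hprim p pp (by tauto)))
  have := jac_prod a b c oa ob oc h1 h2 h3
  rw [j1, j2, j3] at this
  split_ifs at this with hm
  · rw [Nat.odd_iff] at oa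
    refine aux_odd a b c x y z w (2*(a*b*c)^2*j) (by omega) ?_ (hprim 2 Nat.prime_two) (by omega) (by omega)
    rw [hn] at h
    linear_combination h
  · norm_num at this

lemma core_even (a b c : ℕ) (n x y z w j : ℤ) (sa : Squarefree a) (sb : Squarefree b) (sc : Squarefree c)
    (h1 : a.Coprime b) (h2 : a.Coprime c) (h3 : b.Coprime c)
    (ea : Even a)
    (hn : n = -(a*b*c) + 16 * (a*b*c)^2 * j) (h : n * w^2 = a*x^2+b*y^2+c*z^2)
    (hprim : ∀ p : ℕ, p.Prime → ¬ ((p:ℤ) ∣ x ∧ (p:ℤ) ∣ y ∧ (p:ℤ) ∣ z ∧ (p:ℤ) ∣ w)) : False := by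
  obtain ⟨d, rfl⟩ := even_iff_two_dvd.1 ea
  have ob : Odd b := by
    rw [← Nat.coprime_two_left]; exact Nat.Coprime.coprime_mul_right h1
  have oc : Odd c := by
    rw [← Nat.coprime_two_left]; exact Nat.Coprime.coprime_mul_right h2
  have od : Odd d := by
    rw [← Nat.not_even_iff_odd]
    intro hd
    have := sa 2 (mul_dvd_mul_left 2 (even_iff_two_dvd.1 hd))
    simp at this
  have g1 : d.Coprime b := Nat.Coprime.coprime_mul_left h1
  have g2 : d.Coprime c := Nat.Coprime.coprime_mul_left h2
  have j1 := aux_jac d (-(b*c)) (fun p pp hp => core_p (2*d) b c n x y z w j sa h1 h2 hn h hprim p pp (hp.mul_left 2))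
  have j2 := aux_jac b (-((2*d:ℕ)*c)) (core_p b (2*d) c n y x z w j sb h1.symm h3 (by rw [hn]; ring) (by rw [h]; ring)
    (fun p pp hh => hprim p pp (by tauto)))
  have j3 := aux_jac c (-((2*d:ℕ)*b)) (core_p c (2*d) b n z x y w j sc h2.symm h3.symm (by rw [hn]; ring) (by rw [h]; ring)
    (fun p pp hh => hprim p pp (by tauto)))
  have J := jac_prod d b c od ob oc g1 g2 h3
  rw [show (-((2*d:ℕ)*c) : ℤ) = 2 * (-(d*c)) by push_cast; ring, jacobiSym.mul_left, jacobiSym.at_two ob,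
    ZMod.χ₈_nat_eq_if_mod_eight] at j2
  rw [show (-((2*d:ℕ)*b) : ℤ) = 2 * (-(d*b)) by push_cast; ring, jacobiSym.mul_left, jacobiSym.at_two oc,
    ZMod.χ₈_nat_eq_if_mod_eight] at j3
  rw [j1, one_mul] at J
  rw [Nat.odd_iff] at ob oc od
  have E := aux_even d b c x y z w (4*(d*b*c)^2*j) (by omega) (by omega) (by omega) (by
    rw [hn] at h
    push_cast at h
    linear_combination h) (hprim 2 Nat.prime_two)
  generalize jacobiSym (-(d*c)) b = u at *
  generalize jacobiSym (-(d*b)) c = v at *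
  clear h hn hprim j1 h1 h2 g1 g2 h3 sa sb sc
  have hb8 : b % 8 = 1 ∨ b % 8 = 3 ∨ b % 8 = 5 ∨ b % 8 = 7 := by omega
  have hc8 : c % 8 = 1 ∨ c % 8 = 3 ∨ c % 8 = 5 ∨ c % 8 = 7 := by omega
  have hd8 : d % 4 = 1 ∨ d % 4 = 3 := by omega
  split_ifs at j2 j3 J
  all_goals first
    | omega
    | (have hu : u = 1 := by linarith
       have hv : v = 1 := by linarith
       subst hu hv
       first | (exfalso; rcases hb8 with hb8|hb8|hb8|hb8 <;> rcases hc8 with hc8|hc8|hc8|hc8 <;> rcases hd8 with hd8|hd8 <;> omega) | (norm_num at J; done))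
    | (have hu : u = 1 := by linarith
       have hv : v = -1 := by linarith
       subst hu hv
       first | (exfalso; rcases hb8 with hb8|hb8|hb8|hb8 <;> rcases hc8 with hc8|hc8|hc8|hc8 <;> rcases hd8 with hd8|hd8 <;> omega) | (norm_num at J; done))
    | (have hu : u = -1 := by linarith
       have hv : v = 1 := by linarith
       subst hu hv
       first | (exfalso; rcases hb8 with hb8|hb8|hb8|hb8 <;> rcases hc8 with hc8|hc8|hc8|hc8 <;> rcases hd8 with hd8|hd8 <;> omega) | (norm_num at J; done))
    | (have hu : u = -1 := by linarith
       have hv : v = -1 := by linarith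
       subst hu hv
       first | (exfalso; rcases hb8 with hb8|hb8|hb8|hb8 <;> rcases hc8 with hc8|hc8|hc8|hc8 <;> rcases hd8 with hd8|hd8 <;> omega) | (norm_num at J; done))

lemma core (a b c : ℕ) (n x y z w j : ℤ) (sa : Squarefree a) (sb : Squarefree b) (sc : Squarefree c)
    (h1 : a.Coprime b) (h2 : a.Coprime c) (h3 : b.Coprime c)
    (hn : n = -(a*b*c) + 16 * (a*b*c)^2 * j) (h : n * w^2 = a*x^2+b*y^2+c*z^2)
    (hprim : ∀ p : ℕ, p.Prime → ¬ ((p:ℤ) ∣ x ∧ (p:ℤ) ∣ y ∧ (p:ℤ) ∣ z ∧ (p:ℤ) ∣ w)) : False := by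
  rcases Nat.even_or_odd a with ea | oa
  · exact core_even a b c n x y z w j sa sb sc h1 h2 h3 ea hn h hprim
  rcases Nat.even_or_odd b with eb | ob
  · exact core_even b a c n y x z w j sb sa sc h1.symm h3 h2 eb (by rw [hn]; ring) (by rw [h]; ring)
      (fun p pp hh => hprim p pp (by tauto))
  rcases Nat.even_or_odd c with ec | oc
  · exact core_even c a b n z x y w j sc sa sb h2.symm h3.symm h1 ec (by rw [hn]; ring) (by rw [h]; ring)
      (fun p pp hh => hprim p pp (by tauto))
  exact core_odd a b c n x y z w j sa sb sc h1 h2 h3 oa ob oc hn h hprim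

lemma core_rat (a b c : ℕ) (n j : ℤ) (X Y Z : ℚ) (sa : Squarefree a) (sb : Squarefree b) (sc : Squarefree c)
    (h1 : a.Coprime b) (h2 : a.Coprime c) (h3 : b.Coprime c)
    (hn : n = -(a*b*c) + 16 * (a*b*c)^2 * j) (h : (n:ℚ) = a*X^2+b*Y^2+c*Z^2) : False := by
  have key : ∀ w : ℕ, 0 < w → ∀ x y z : ℤ, n * (w:ℤ)^2 = a*x^2+b*y^2+c*z^2 → False := by
    intro w
    induction w using Nat.strong_induction_on with
    | _ w ih =>
      intro hw x y z hxyz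
      refine core a b c n x y z w j sa sb sc h1 h2 h3 hn hxyz ?_
      rintro p pp ⟨⟨x, rfl⟩, ⟨y, rfl⟩, ⟨z, rfl⟩, hpw⟩
      obtain ⟨w, rfl⟩ : p ∣ w := by exact_mod_cast hpw
      have hw' : 0 < w := Nat.pos_of_mul_pos_left hw
      refine ih w ?_ hw' x y z ?_
      · nlinarith [pp.two_le]
      · have hp0 : (p:ℤ)^2 ≠ 0 := by
          have := pp.pos
          positivity
        apply mul_left_cancel₀ hp0
        push_cast at hxyz
        linear_combination hxyz
  refine key (X.den*Y.den*Z.den) (by have := X.pos; have := Y.pos; have := Z.pos; positivity)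
    (X.num*Y.den*Z.den) (Y.num*X.den*Z.den) (Z.num*X.den*Y.den) ?_
  have hX := Rat.mul_den_eq_num X
  have hY := Rat.mul_den_eq_num Y
  have hZ := Rat.mul_den_eq_num Z
  have : ((n:ℚ) * ((X.den:ℚ)*Y.den*Z.den)^2 = a*((X.num:ℚ)*Y.den*Z.den)^2+b*((Y.num:ℚ)*X.den*Z.den)^2+c*((Z.num:ℚ)*X.den*Y.den)^2) := by
    rw [← hX, ← hY, ← hZ, h]; ring
  exact_mod_cast this

def Good17 (S : Set ℚ) (a b c : ℕ) : Prop :=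
  0 < a ∧ 0 < b ∧ 0 < c ∧ ∃ t : ℕ, 0 < t ∧ ∀ s ∈ S, ∃ X Y Z : ℚ, a*X^2+b*Y^2+c*Z^2 = t * s

lemma Good17.swap {S : Set ℚ} {a b c : ℕ} (h : Good17 S a b c) : Good17 S b a c := by
  obtain ⟨ha, hb, hc, t, ht, h⟩ := h
  refine ⟨hb, ha, hc, t, ht, fun s hs => ?_⟩
  obtain ⟨X, Y, Z, e⟩ := h s hs
  exact ⟨Y, X, Z, by rw [← e]; ring⟩

lemma Good17.rot {S : Set ℚ} {a b c : ℕ} (h : Good17 S a b c) : Good17 S b c a := by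
  obtain ⟨ha, hb, hc, t, ht, h⟩ := h
  refine ⟨hb, hc, ha, t, ht, fun s hs => ?_⟩
  obtain ⟨X, Y, Z, e⟩ := h s hs
  exact ⟨Y, Z, X, by rw [← e]; ring⟩

lemma Good17.sq {S : Set ℚ} {p a b c : ℕ} (h : Good17 S (p*p*a) b c) : Good17 S a b c := by
  obtain ⟨ha, hb, hc, t, ht, h⟩ := h
  refine ⟨Nat.pos_of_mul_pos_left ha, hb, hc, t, ht, fun s hs => ?_⟩
  obtain ⟨X, Y, Z, e⟩ := h s hs
  exact ⟨p*X, Y, Z, by rw [← e]; push_cast; ring⟩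

lemma Good17.cop {S : Set ℚ} {p a b c : ℕ} (hp : 0 < p) (h : Good17 S (p*a) (p*b) c) : Good17 S a b (p*c) := by
  obtain ⟨ha, hb, hc, t, ht, h⟩ := h
  refine ⟨Nat.pos_of_mul_pos_left ha, Nat.pos_of_mul_pos_left hb, by positivity, p*t, by positivity, fun s hs => ?_⟩
  obtain ⟨X, Y, Z, e⟩ := h s hs
  exact ⟨p*X, p*Y, Z, by push_cast at e ⊢; linear_combination (p:ℚ)*e⟩

lemma Good17.reduce {S : Set ℚ} (m : ℕ) : ∀ a b c : ℕ, a*b*c = m → Good17 S a b c →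
    ∃ a b c : ℕ, Good17 S a b c ∧ Squarefree a ∧ Squarefree b ∧ Squarefree c ∧ a.Coprime b ∧ a.Coprime c ∧ b.Coprime c := by
  induction m using Nat.strong_induction_on with
  | _ m ih =>
    have S1 : ∀ a b c : ℕ, a*b*c = m → Good17 S a b c → ¬ Squarefree a →
      ∃ a b c : ℕ, Good17 S a b c ∧ Squarefree a ∧ Squarefree b ∧ Squarefree c ∧ a.Coprime b ∧ a.Coprime c ∧ b.Coprime c := by
      intro a b c hm hg hs
      rw [Nat.squarefree_iff_prime_squarefree] at hs
      push Not at hs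
      obtain ⟨p, pp, a', rfl⟩ := hs
      have hg' := hg.sq
      refine ih (a'*b*c) ?_ a' b c rfl hg'
      have : 0 < a'*b*c := Nat.mul_pos (Nat.mul_pos hg'.1 hg'.2.1) hg'.2.2.1
      have h2 := pp.two_le
      have : 1 < p*p := by nlinarith
      calc a'*b*c < (p*p)*(a'*b*c) := by nlinarith
        _ = m := by rw [← hm]; ring
    have S2 : ∀ a b c : ℕ, a*b*c = m → Good17 S a b c → ¬ a.Coprime b →
      ∃ a b c : ℕ, Good17 S a b c ∧ Squarefree a ∧ Squarefree b ∧ Squarefree c ∧ a.Coprime b ∧ a.Coprime c ∧ b.Coprime c := by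
      intro a b c hm hg hs
      obtain ⟨p, pp, ⟨a', rfl⟩, ⟨b', rfl⟩⟩ := Nat.Prime.not_coprime_iff_dvd.1 hs
      have hg' := hg.cop pp.pos
      refine ih (a'*b'*(p*c)) ?_ a' b' (p*c) rfl hg'
      have : 0 < a'*b'*(p*c) := Nat.mul_pos (Nat.mul_pos hg'.1 hg'.2.1) hg'.2.2.1
      have h2 := pp.two_le
      calc a'*b'*(p*c) < p*(a'*b'*(p*c)) := by nlinarith
        _ = m := by rw [← hm]; ring
    intro a b c hm hg
    by_cases sa : Squarefree a
    swap
    · exact S1 a b c hm hg sa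
    by_cases sb : Squarefree b
    swap
    · exact S1 b c a (by rw [← hm]; ring) hg.rot sb
    by_cases sc : Squarefree c
    swap
    · exact S1 c a b (by rw [← hm]; ring) hg.rot.rot sc
    by_cases h1 : a.Coprime b
    swap
    · exact S2 a b c hm hg h1
    by_cases h2 : a.Coprime c
    swap
    · exact S2 a c b (by rw [← hm]; ring) hg.swap.rot h2
    by_cases h3 : b.Coprime c
    swap
    · exact S2 b c a (by rw [← hm]; ring) hg.rot h3
    exact ⟨a, b, c, hg, sa, sb, sc, h1, h2, h3⟩

lemma good_start (S : Set ℚ) (α β γ : ℚ) (hα : 0 < α) (hβ : 0 < β) (hγ : 0 < γ)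
    (h : ∀ s ∈ S, ∃ X Y Z : ℚ, α*X^2+β*Y^2+γ*Z^2 = s) :
    ∃ a b c : ℕ, Good17 S a b c := by
  have ha := Rat.num_pos.2 hα
  have hb := Rat.num_pos.2 hβ
  have hc := Rat.num_pos.2 hγ
  have da := α.pos
  have db := β.pos
  have dc := γ.pos
  have ea := Rat.mul_den_eq_num α
  have eb := Rat.mul_den_eq_num β
  have ec := Rat.mul_den_eq_num γ
  obtain ⟨a, ha'⟩ := Int.eq_ofNat_of_zero_le ha.le
  obtain ⟨b, hb'⟩ := Int.eq_ofNat_of_zero_le hb.le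
  obtain ⟨c, hc'⟩ := Int.eq_ofNat_of_zero_le hc.le
  rw [ha'] at ha ea
  rw [hb'] at hb eb
  rw [hc'] at hc ec
  have ha : 0 < a := by exact_mod_cast ha
  have hb : 0 < b := by exact_mod_cast hb
  have hc : 0 < c := by exact_mod_cast hc
  refine ⟨a*β.den*γ.den, b*α.den*γ.den, c*α.den*β.den, by positivity, by positivity, by positivity,
    α.den*β.den*γ.den, by positivity, fun s hs => ?_⟩
  obtain ⟨X, Y, Z, e⟩ := h s hs
  refine ⟨X, Y, Z, ?_⟩
  rw [← e]
  push_cast at ea eb ec ⊢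
  rw [← ea, ← eb, ← ec]
  ring

lemma good_final (S : Set ℚ) (a b c : ℕ) (h : Good17 S a b c) :
    ∃ M r : ℕ, 0 < M ∧ 0 < r ∧ ∀ N : ℕ, 0 < N → N ≡ r [MOD M] → (N:ℚ) ∉ S := by
  obtain ⟨a, b, c, ⟨ha, hb, hc, t, ht, h⟩, sa, sb, sc, h1, h2, h3⟩ := Good17.reduce _ a b c rfl h
  have hK : 0 < a*b*c := by positivity
  have hlt : a*b*c < 16*(a*b*c)^2 := by nlinarith
  refine ⟨t*(16*(a*b*c)^2), t*(16*(a*b*c)^2 - a*b*c), by positivity, Nat.mul_pos ht (by omega), ?_⟩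
  intro N hN hmod hS
  obtain ⟨k, hk⟩ := (Nat.modEq_iff_dvd.1 hmod.symm)
  rw [Nat.cast_mul, Nat.cast_sub hlt.le] at hk
  push_cast at hk
  obtain ⟨X, Y, Z, e⟩ := h _ hS
  have ht' : (t:ℚ) ≠ 0 := by positivity
  refine core_rat a b c (-(a*b*c) + 16 * (a*b*c)^2 * (k+1)) (k+1) (X/t) (Y/t) (Z/t) sa sb sc h1 h2 h3 rfl ?_
  have hk' : (N:ℚ) = t * (-(a*b*c) + 16 * (a*b*c)^2 * (k+1)) := by
    have : (N:ℤ) = t * (-(a*b*c) + 16 * (a*b*c)^2 * (k+1)) := by linear_combination hk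
    exact_mod_cast this
  rw [hk'] at e
  push_cast
  field_simp
  linear_combination -e


theorem stmt17 (q11 q22 q33 q12 q13 q23 : ℚ)
    (hpos : ∀ x y z : ℚ, ¬ (x = 0 ∧ y = 0 ∧ z = 0) →
      0 < q11 * x ^ 2 + q22 * y ^ 2 + q33 * z ^ 2 + q12 * x * y + q13 * x * z + q23 * y * z) :
    (∃ M r : ℕ, 0 < M ∧ 0 < r ∧ ∀ N : ℕ, 0 < N → N ≡ r [MOD M] →
      ¬ ∃ x y z : ℚ, q11 * x ^ 2 + q22 * y ^ 2 + q33 * z ^ 2 +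
        q12 * x * y + q13 * x * z + q23 * y * z = (N : ℚ)) ∧
    {N : ℕ | 0 < N ∧ ¬ ∃ x y z : ℚ, q11 * x ^ 2 + q22 * y ^ 2 + q33 * z ^ 2 +
        q12 * x * y + q13 * x * z + q23 * y * z = (N : ℚ)}.Infinite := by
  have p1 : 0 < q11 := by simpa using hpos 1 0 0 (by simp)
  have pA : 0 < 4*q11*q22 - q12^2 := by
    have := hpos (-q12) (2*q11) 0 (by simp [p1.ne'])
    have h2 : 0 < q11 * (4*q11*q22 - q12^2) := by nlinarith
    exact pos_of_mul_pos_right h2 p1.le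
  obtain ⟨A, hA⟩ : ∃ A, A = 4*q11*q22 - q12^2 := ⟨_, rfl⟩
  obtain ⟨B, hB⟩ : ∃ B, B = 2*q11*q23 - q12*q13 := ⟨_, rfl⟩
  obtain ⟨C, hC⟩ : ∃ C, C = 4*q11*q33 - q13^2 := ⟨_, rfl⟩
  rw [← hA] at pA
  have ident : ∀ x y z : ℚ, 4*q11*A*(q11 * x ^ 2 + q22 * y ^ 2 + q33 * z ^ 2 + q12 * x * y + q13 * x * z + q23 * y * z)
      = A*(2*q11*x+q12*y+q13*z)^2 + (A*y+B*z)^2 + (A*C-B^2)*z^2 := by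
    intro x y z
    rw [hA, hB, hC]; ring
  have pD : 0 < A*C-B^2 := by
    have h1 := hpos ((q12*B-q13*A)/(2*q11)) (-B) A (by simp [pA.ne'])
    have h2 := ident ((q12*B-q13*A)/(2*q11)) (-B) A
    have h3 : 2*q11*((q12*B-q13*A)/(2*q11)) = q12*B-q13*A := by field_simp
    rw [h3] at h2
    have h4 := mul_pos (mul_pos (mul_pos (by norm_num : (0:ℚ) < 4) p1) pA) h1
    rw [h2] at h4
    have h5 : 0 < (A*C-B^2) * A^2 := by linarith [h4, show A * (q12 * B - q13 * A + q12 * -B + q13 * A) ^ 2 + (A * -B + B * A) ^ 2 = 0 by ring]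
    exact pos_of_mul_pos_left h5 (by positivity)
  obtain ⟨a, b, c, hg⟩ := good_start {s : ℚ | ∃ x y z : ℚ, q11 * x ^ 2 + q22 * y ^ 2 + q33 * z ^ 2 +
        q12 * x * y + q13 * x * z + q23 * y * z = s} (1/(4*q11)) (1/(4*q11*A)) ((A*C-B^2)/(4*q11*A))
        (by positivity) (by positivity) (by positivity) (by
      rintro s ⟨x, y, z, rfl⟩
      refine ⟨2*q11*x+q12*y+q13*z, A*y+B*z, z, ?_⟩
      have := ident x y z
      have e : (q11 * x ^ 2 + q22 * y ^ 2 + q33 * z ^ 2 + q12 * x * y + q13 * x * z + q23 * y * z)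
        = (A*(2*q11*x+q12*y+q13*z)^2 + (A*y+B*z)^2 + (A*C-B^2)*z^2) / (4*q11*A) := by
        rw [← this]; field_simp
      rw [e]; field_simp)
  obtain ⟨M, r, hM, hr, hN⟩ := good_final _ a b c hg
  refine ⟨⟨M, r, hM, hr, hN⟩, ?_⟩
  apply Set.infinite_of_injective_forall_mem (f := fun k : ℕ => r + M * k)
  · intro k l hkl
    have : M * k = M * l := Nat.add_left_cancel hkl
    exact Nat.eq_of_mul_eq_mul_left hM this
  · intro k
    exact ⟨by positivity, hN _ (by positivity) (by simp [Nat.ModEq])⟩
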